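/- Let A be a finite-dimensional ℚ-algebra with the hyperbolic property and with nonzero Jacobson radical J(A). Then either J(A) is contained in the center of A, or A is isomorphic as a ℚ-algebra to B × T₂(ℚ), where B is a finite-dimensional semisimple reduced ℚ-algebra (i.e., a finite direct product of division algebras) and T₂(ℚ) is the algebra of upper triangular 2×2 matrices over ℚ. -/

import Mathlib

/-- A `ℤ`-order in a finite-dimensional `ℚ`-algebra `A`. -/
def IsZOrder (A : Type*) [Ring A] [Algebra ℚ A] (Γ : Subring A) : Prop :=
  Γ.toAddSubgroup.FG ∧ Submodule.span ℚ (Γ : Set A) = ⊤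

/-- A group `G` contains a subgroup isomorphic to `ℤ × ℤ`. -/
def HasZxZ (G : Type*) [Group G] : Prop :=
  ∃ f : Multiplicative (ℤ × ℤ) →* G, Function.Injective f

/-- The hyperbolic property: no `ℤ`-order of `A` has a unit group containing `ℤ × ℤ`. -/
def HasHyperbolicProperty (A : Type*) [Ring A] [Algebra ℚ A] : Prop :=
  ∀ Γ : Subring A, IsZOrder A Γ → ¬ HasZxZ Γˣ

/-- The `ℚ`-algebra of upper triangular `2 × 2` matrices over `ℚ`. -/
def T2Q : Subalgebra ℚ (Matrix (Fin 2) (Fin 2) ℚ) where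
  carrier := {M | M 1 0 = 0}
  mul_mem' := by
    intro a b ha hb
    simp only [Set.mem_setOf_eq] at *
    simp [Matrix.mul_apply, Fin.sum_univ_two, ha, hb]
  add_mem' := by
    intro a b ha hb
    simp only [Set.mem_setOf_eq] at *
    simp [ha, hb]
  algebraMap_mem' := by
    intro q
    simp [Matrix.algebraMap_eq_diagonal, Matrix.diagonal]


theorem exists_mul_mem_span {A : Type*} [Ring A] [Algebra ℚ A] {ι : Type*} (b : Module.Basis ι ℚ A) (a : A) :
    ∃ N : ℕ, N ≠ 0 ∧ N • a ∈ Submodule.span ℤ (Set.range b) := by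
  have ha : a ∈ Submodule.span ℚ (Set.range b) := by simp [b.span_eq]
  induction ha using Submodule.span_induction with
  | mem x hx => exact ⟨1, one_ne_zero, by simpa using Submodule.subset_span hx⟩
  | zero => exact ⟨1, one_ne_zero, by simp⟩
  | add x y _ _ hx hy =>
    obtain ⟨N, hN, h1⟩ := hx
    obtain ⟨M, hM, h2⟩ := hy
    refine ⟨M * N, mul_ne_zero hM hN, ?_⟩
    have e : (M * N) • (x + y) = M • (N • x) + N • (M • y) := by
      rw [smul_add, mul_smul, mul_comm M N, mul_smul N M y]
    rw [e]
    exact add_mem (nsmul_mem h1 _) (nsmul_mem h2 _)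
  | smul q x _ hx =>
    obtain ⟨N, hN, h1⟩ := hx
    refine ⟨q.den * N, mul_ne_zero q.den_nz hN, ?_⟩
    have e : (q.den * N) • (q • x) = q.num • (N • x) := by
      rw [← Nat.cast_smul_eq_nsmul ℚ, ← Nat.cast_smul_eq_nsmul ℚ, ← Int.cast_smul_eq_zsmul ℚ,
        smul_smul, smul_smul]
      congr 1
      push_cast
      rw [mul_right_comm, Rat.den_mul_eq_num]
    rw [e]
    exact zsmul_mem h1 _

theorem exists_order (A : Type*) [Ring A] [Algebra ℚ A] [FiniteDimensional ℚ A] :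
    ∃ Γ : Subring A, IsZOrder A Γ ∧ ∀ a : A, ∃ N : ℕ, N ≠ 0 ∧ N • a ∈ Γ := by
  classical
  let b := Module.finBasis ℚ A
  let L := Submodule.span ℤ (Set.range b)
  let Γ : Subring A :=
    { carrier := {a | ∀ l ∈ L, a * l ∈ L}
      mul_mem' := fun {x y} hx hy l hl => by
        rw [mul_assoc]; exact hx _ (hy _ hl)
      one_mem' := fun l hl => by simpa using hl
      add_mem' := fun {x y} hx hy l hl => by
        rw [add_mul]; exact add_mem (hx _ hl) (hy _ hl)
      zero_mem' := fun l hl => by simp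
      neg_mem' := fun {x} hx l hl => by
        rw [neg_mul]; exact neg_mem (hx _ hl) }
  have hΓ : ∀ a, a ∈ Γ ↔ ∀ l ∈ L, a * l ∈ L := fun a => Iff.rfl
  have hmul : ∀ a : A, ∃ N : ℕ, N ≠ 0 ∧ N • a ∈ Γ := by
    intro a
    choose N hN h using fun i => exists_mul_mem_span b (a * b i)
    refine ⟨∏ i, N i, Finset.prod_ne_zero_iff.2 fun i _ => hN i, ?_⟩
    rw [hΓ]
    intro l hl
    induction hl using Submodule.span_induction with
    | mem x hx =>
      obtain ⟨i, rfl⟩ := hx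
      rw [← Finset.prod_erase_mul _ _ (Finset.mem_univ i), smul_mul_assoc, mul_smul]
      exact nsmul_mem (h i) _
    | zero => simp
    | add x y _ _ hx hy => rw [mul_add]; exact add_mem hx hy
    | smul q x _ hx => rw [mul_smul_comm]; exact L.smul_mem _ hx
  refine ⟨Γ, ⟨?_, ?_⟩, hmul⟩
  · obtain ⟨N, hN, h1⟩ := exists_mul_mem_span b 1
    have : Module.Finite ℤ L := Module.Finite.span_of_finite ℤ (Set.finite_range b)
    let G : Submodule ℤ A := Γ.toAddSubgroup.toIntSubmodule
    let f : G →ₗ[ℤ] L :=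
      { toFun := fun a => ⟨N • (a : A), by
          have := (hΓ a).1 a.2 _ h1
          rwa [mul_smul_comm, mul_one] at this⟩
        map_add' := fun x y => Subtype.ext (smul_add N (x : A) (y : A))
        map_smul' := fun c x => Subtype.ext (smul_comm N c (x : A)) }
    have hf : Function.Injective f := by
      intro x y hxy
      have h2 : N • (x : A) = N • (y : A) := congrArg Subtype.val hxy
      rw [← Nat.cast_smul_eq_nsmul ℚ, ← Nat.cast_smul_eq_nsmul ℚ] at h2
      exact Subtype.ext (smul_right_injective A (Nat.cast_ne_zero.2 hN : (N : ℚ) ≠ 0) h2)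
    have : Module.Finite ℤ G := Module.Finite.of_injective f hf
    have h3 : G.FG := Module.Finite.iff_fg.1 this
    have := (Submodule.fg_iff_addSubgroup_fg G).1 h3
    simpa [G] using this
  · rw [eq_top_iff]
    intro a _
    obtain ⟨N, hN, h⟩ := hmul a
    have e : a = (N : ℚ)⁻¹ • (N • a) := by
      rw [← Nat.cast_smul_eq_nsmul ℚ, smul_smul, inv_mul_cancel₀ (Nat.cast_ne_zero.2 hN), one_smul]
    rw [e]
    exact Submodule.smul_mem _ _ (Submodule.subset_span h)

theorem z2_aux {A : Type*} [Ring A] [Algebra ℚ A] (Γ : Subring A) (x y : A) (c : ℚ)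
    (hx : x ∈ Γ) (hy : y ∈ Γ) (hx0 : x ≠ 0) (hxx : x * x = 0) (hxy : x * y = 0) (hyx : y * x = 0)
    (hyy : y * y = c • x) (hind : y ∉ Submodule.span ℚ {x}) : HasZxZ Γˣ := by
  let X : Γ := ⟨x, hx⟩
  let Y : Γ := ⟨y, hy⟩
  have hXX : X * X = 0 := Subtype.ext hxx
  have hXY : X * Y = 0 := Subtype.ext hxy
  have hYX : Y * X = 0 := Subtype.ext hyx
  have hYYY : Y * Y * Y = 0 := Subtype.ext (by
    change y * y * y = 0
    rw [hyy, smul_mul_assoc, hxy, smul_zero])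
  have hYYY' : Y * (Y * Y) = 0 := by rw [← mul_assoc, hYYY]
  let v : Γˣ := ⟨1 + X, 1 - X, by simp [mul_sub, add_mul, hXX], by simp [mul_add, sub_mul, hXX]⟩
  let u : Γˣ := ⟨1 + Y, 1 - Y + Y * Y, by
      simp only [mul_add, mul_sub, add_mul, one_mul, mul_one, hYYY']; abel, by
      simp only [mul_add, sub_mul, add_mul, one_mul, mul_one, hYYY]; abel⟩
  have huv : Commute u v := Units.ext (by
    change (1 + Y) * (1 + X) = (1 + X) * (1 + Y)
    simp only [mul_add, add_mul, one_mul, mul_one, hXY, hYX]; abel)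
  have hv : ∀ n : ℤ, (((v ^ n : Γˣ) : Γ) : A) = 1 + (n : ℚ) • x := by
    intro n
    induction n using Int.induction_on with
    | zero => simp
    | succ n ih =>
      rw [zpow_add_one, Units.val_mul, Subring.coe_mul, ih]
      change _ * (1 + x) = _
      push_cast
      simp only [mul_add, add_mul, one_mul, mul_one, smul_mul_assoc, hxx, smul_zero, add_smul, one_smul]
      abel
    | pred n ih =>
      rw [zpow_sub_one, Units.val_mul, Subring.coe_mul, ih]
      change _ * (1 - x) = _
      push_cast
      simp only [mul_sub, add_mul, one_mul, mul_one, smul_mul_assoc, hxx, smul_zero, sub_smul, one_smul]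
      abel
  have hu : ∀ n : ℤ, ∃ q : ℚ, (((u ^ n : Γˣ) : Γ) : A) = 1 + (n : ℚ) • y + q • x := by
    intro n
    induction n using Int.induction_on with
    | zero => exact ⟨0, by simp⟩
    | succ n ih =>
      obtain ⟨q, ih⟩ := ih
      refine ⟨q + n * c, ?_⟩
      rw [zpow_add_one, Units.val_mul, Subring.coe_mul, ih]
      change _ * (1 + y) = _
      push_cast
      simp only [mul_add, add_mul, one_mul, mul_one, smul_mul_assoc, hyy, hxy, smul_zero, add_smul,
        one_smul, smul_smul]
      abel
    | pred n ih =>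
      obtain ⟨q, ih⟩ := ih
      refine ⟨q + n * c + c, ?_⟩
      rw [zpow_sub_one, Units.val_mul, Subring.coe_mul, ih]
      change _ * (1 - y + y * y) = _
      push_cast
      rw [hyy]
      simp only [mul_add, mul_sub, add_mul, one_mul, mul_one, smul_mul_assoc, mul_smul_comm, hyy, hxy, hxx, hyx, smul_zero, add_smul, sub_smul,
        one_smul, smul_smul, neg_smul, neg_mul]
      abel_nf
  have key : ∀ n m : ℤ, u ^ n * v ^ m = 1 → n = 0 ∧ m = 0 := by
    intro n m h
    obtain ⟨q, hq⟩ := hu n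
    have h1 : (((u ^ n * v ^ m : Γˣ) : Γ) : A) = 1 := by rw [h]; simp
    rw [Units.val_mul, Subring.coe_mul, hq, hv] at h1
    simp only [mul_add, add_mul, one_mul, mul_one, smul_mul_assoc, mul_smul_comm, hxx, hyx, smul_zero, add_zero] at h1
    have h2 : (n : ℚ) • y + (q + m) • x = 0 := by
      rw [add_smul]
      have h3 : 1 + ((n : ℚ) • y + (q • x + (m : ℚ) • x)) = 1 + 0 := by
        rw [add_zero]; rw [← add_assoc, ← add_assoc, h1]
      exact add_left_cancel h3
    have hn : n = 0 := by
      by_contra hn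
      apply hind
      rw [Submodule.mem_span_singleton]
      refine ⟨- (n : ℚ)⁻¹ * (q + m), ?_⟩
      rw [mul_smul, eq_neg_of_add_eq_zero_right h2, smul_neg, neg_smul, neg_neg, smul_smul,
        inv_mul_cancel₀ (Int.cast_ne_zero.2 hn), one_smul]
    subst hn
    refine ⟨rfl, ?_⟩
    rw [zpow_zero, one_mul] at h
    have h4 := hv m
    rw [h] at h4
    have h5 : (m : ℚ) • x = 0 := by simpa using h4
    rcases smul_eq_zero.1 h5 with h6 | h6
    · exact_mod_cast h6
    · exact absurd h6 hx0
  refine ⟨{ toFun := fun p => u ^ (Multiplicative.toAdd p).1 * v ^ (Multiplicative.toAdd p).2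
            map_one' := by simp
            map_mul' := fun p q => ?_ }, ?_⟩
  · simp only [toAdd_mul, Prod.fst_add, Prod.snd_add, zpow_add]
    rw [mul_assoc, mul_assoc, ← mul_assoc (u ^ _) (v ^ _) (v ^ _),
      ((huv.zpow_zpow _ _).eq), mul_assoc]
  · rw [injective_iff_map_eq_one]
    intro p hp
    obtain ⟨h1, h2⟩ := key _ _ hp
    exact Multiplicative.toAdd.injective (Prod.ext h1 h2)

theorem z2_lemma {A : Type*} [Ring A] [Algebra ℚ A] [FiniteDimensional ℚ A]
    (hA : HasHyperbolicProperty A) (x y : A) (hx0 : x ≠ 0) (hxx : x * x = 0)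
    (hxy : x * y = 0) (hyx : y * x = 0) (hy : IsNilpotent y) : y ∈ Submodule.span ℚ {x} := by
  classical
  by_contra hind
  obtain ⟨n, hn⟩ := hy
  have hex : ∃ n : ℕ, y ^ (n + 1) ∈ Submodule.span ℚ {x} :=
    ⟨n, by rw [pow_succ, hn, zero_mul]; exact zero_mem _⟩
  have h1 := Nat.find_spec hex
  have h2 : ∀ m < Nat.find hex, y ^ (m + 1) ∉ Submodule.span ℚ {x} := fun m => Nat.find_min hex
  obtain ⟨k, hk⟩ : ∃ k, Nat.find hex = k + 1 := by
    apply Nat.exists_eq_succ_of_ne_zero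
    intro h0
    rw [h0] at h1
    exact hind (by simpa using h1)
  rw [hk] at h1 h2
  have hz := h2 k (Nat.lt_succ_self k)
  have hxz : x * y ^ (k + 1) = 0 := by rw [pow_succ', ← mul_assoc, hxy, zero_mul]
  have hzx : y ^ (k + 1) * x = 0 := by rw [pow_succ, mul_assoc, hyx, mul_zero]
  have hzz : y ^ (k + 1) * y ^ (k + 1) ∈ Submodule.span ℚ {x} := by
    obtain ⟨c, hc⟩ := Submodule.mem_span_singleton.1 h1
    have e : y ^ (k + 1) * y ^ (k + 1) = y ^ (k + 1 + 1) * y ^ k := by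
      rw [← pow_add, ← pow_add]; congr 1; ring
    rw [e, ← hc, smul_mul_assoc]
    cases k with
    | zero => rw [pow_zero, mul_one]; exact Submodule.smul_mem _ _ (Submodule.mem_span_singleton_self x)
    | succ k => rw [pow_succ', ← mul_assoc, hxy, zero_mul, smul_zero]; exact zero_mem _
  generalize y ^ (k + 1) = z at *
  obtain ⟨c, hc⟩ := Submodule.mem_span_singleton.1 hzz
  obtain ⟨Γ, hΓ, hmul⟩ := exists_order A
  obtain ⟨N, hN, hNx⟩ := hmul x
  obtain ⟨M, hM, hMz⟩ := hmul z
  rw [← Nat.cast_smul_eq_nsmul ℚ] at hNx hMz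
  have hN' : (N : ℚ) ≠ 0 := Nat.cast_ne_zero.2 hN
  have hM' : (M : ℚ) ≠ 0 := Nat.cast_ne_zero.2 hM
  refine hA Γ hΓ (z2_aux Γ ((N : ℚ) • x) ((M : ℚ) • z) (M * M * c * (N : ℚ)⁻¹) hNx hMz
    (smul_ne_zero hN' hx0) ?_ ?_ ?_ ?_ ?_)
  · simp [hxx]
  · simp [hxz]
  · simp [hzx]
  · rw [smul_mul_smul_comm, ← hc, smul_smul, smul_smul]
    congr 1
    field_simp
  · intro h
    obtain ⟨d, hd⟩ := Submodule.mem_span_singleton.1 h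
    apply hz
    rw [Submodule.mem_span_singleton]
    refine ⟨(M : ℚ)⁻¹ * (d * N), ?_⟩
    rw [mul_smul, mul_smul, hd, smul_smul, inv_mul_cancel₀ hM', one_smul]

theorem exists_radical_gen {A : Type*} [Ring A] [Algebra ℚ A] [FiniteDimensional ℚ A]
    (hA : HasHyperbolicProperty A) (hJ : (⊥ : Ideal A).jacobson ≠ ⊥) :
    ∃ x : A, x ≠ 0 ∧ x * x = 0 ∧ ∀ a, a ∈ (⊥ : Ideal A).jacobson ↔ ∃ q : ℚ, q • x = a := by
  classical
  have : IsArtinianRing A := IsArtinianRing.of_finite ℚ A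
  obtain ⟨n, hn⟩ := IsArtinianRing.isNilpotent_jacobson_bot (R := A)
  set J : Ideal A := (⊥ : Ideal A).jacobson with hJdef
  have hex : ∃ n : ℕ, J ^ (n + 1) = ⊥ := ⟨n, by rw [Submodule.pow_succ, hn]; simp⟩
  have h1 := Nat.find_spec hex
  have h2 : ∀ m < Nat.find hex, J ^ (m + 1) ≠ ⊥ := fun m => Nat.find_min hex
  obtain ⟨k, hk⟩ : ∃ k, Nat.find hex = k + 1 := by
    apply Nat.exists_eq_succ_of_ne_zero
    intro h0
    rw [h0] at h1
    exact hJ (by simpa [Submodule.pow_one] using h1)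
  rw [hk] at h1 h2
  obtain ⟨x, hx, hx0⟩ := (Submodule.ne_bot_iff _).1 (h2 k (Nat.lt_succ_self k))
  have hxJ : x ∈ J := Ideal.pow_le_self (Nat.succ_ne_zero k) hx
  have hl : ∀ y ∈ J, y * x = 0 := by
    intro y hy
    have : y * x ∈ J * J ^ (k + 1) := Ideal.mul_mem_mul hy hx
    rw [← Ideal.IsTwoSided.pow_succ, h1] at this
    simpa using this
  have hr : ∀ y ∈ J, x * y = 0 := by
    intro y hy
    have : x * y ∈ J ^ (k + 1) * J := Ideal.mul_mem_mul hx hy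
    rw [← Submodule.pow_succ, h1] at this
    simpa using this
  have hnil : ∀ y ∈ J, IsNilpotent y := by
    intro y hy
    refine ⟨n, ?_⟩
    have := Ideal.pow_mem_pow hy n
    rw [hn] at this
    simpa using this
  refine ⟨x, hx0, hl x hxJ, fun a => ⟨fun ha => ?_, ?_⟩⟩
  · exact Submodule.mem_span_singleton.1
      (z2_lemma hA x a hx0 (hl x hxJ) (hr a ha) (hl a ha) (hnil a ha))
  · rintro ⟨q, rfl⟩
    rw [Algebra.smul_def]
    exact J.mul_mem_left _ hxJ

theorem exists_char {A : Type*} [Ring A] [Algebra ℚ A] (x : A) (hx0 : x ≠ 0)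
    (h : ∀ a, ∃ q : ℚ, q • x = a * x) : ∃ l : A →ₐ[ℚ] ℚ, ∀ a, a * x = l a • x := by
  choose l hl using h
  have inj : ∀ p q : ℚ, p • x = q • x → p = q := fun p q h => smul_left_injective ℚ hx0 h
  refine ⟨{ toFun := l, map_one' := inj _ _ ?_, map_mul' := fun a b => inj _ _ ?_,
            map_zero' := inj _ _ ?_, map_add' := fun a b => inj _ _ ?_,
            commutes' := fun q => inj _ _ ?_ }, fun a => (hl a).symm⟩
  · simp [hl]
  · rw [hl, mul_assoc, ← hl b, mul_smul_comm, ← hl a, smul_smul, mul_comm]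
  · simp [hl]
  · rw [hl, add_smul, hl, hl, add_mul]
  · rw [hl, ← Algebra.smul_def]; rfl

theorem exists_char' {A : Type*} [Ring A] [Algebra ℚ A] (x : A) (hx0 : x ≠ 0)
    (h : ∀ a, ∃ q : ℚ, q • x = x * a) : ∃ l : A →ₐ[ℚ] ℚ, ∀ a, x * a = l a • x := by
  choose l hl using h
  have inj : ∀ p q : ℚ, p • x = q • x → p = q := fun p q h => smul_left_injective ℚ hx0 h
  refine ⟨{ toFun := l, map_one' := inj _ _ ?_, map_mul' := fun a b => inj _ _ ?_,
            map_zero' := inj _ _ ?_, map_add' := fun a b => inj _ _ ?_,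
            commutes' := fun q => inj _ _ ?_ }, fun a => (hl a).symm⟩
  · simp [hl]
  · rw [hl, ← mul_assoc, ← hl a, smul_mul_assoc, ← hl b, smul_smul]
  · simp [hl]
  · rw [hl, add_smul, hl, hl, mul_add]
  · rw [hl, ← Algebra.commutes, ← Algebra.smul_def]; rfl

/-- The central idempotent splitting off the part annihilated by the radical. -/
theorem exists_g {A : Type*} [Ring A] [Algebra ℚ A] [FiniteDimensional ℚ A]
    (hA : HasHyperbolicProperty A) (x : A) (hx0 : x ≠ 0) (hxx : x * x = 0)
    (hJ : ∀ a, a ∈ (⊥ : Ideal A).jacobson ↔ ∃ q : ℚ, q • x = a)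
    (l r : A →ₐ[ℚ] ℚ) (hl : ∀ a, a * x = l a • x) (hr : ∀ a, x * a = r a • x) :
    ∃ g : A, g * g = g ∧ l g = 0 ∧ r g = 0 ∧ (∀ a, g * a = a * g) ∧
      (∀ k, l k = 0 → r k = 0 → g * k = 0 → ∃ q : ℚ, q • x = k) ∧
      (∀ a, g * a * (g * a) = 0 → g * a = 0) := by
  have : IsArtinianRing A := IsArtinianRing.of_finite ℚ A
  have hsq : ∀ k, l k = 0 → r k = 0 → k * k = 0 → ∃ q : ℚ, q • x = k := by
    intro k h1 h2 h3
    exact Submodule.mem_span_singleton.1 (z2_lemma hA x k hx0 hxx (by simp [hr, h2])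
      (by simp [hl, h1]) ⟨2, by rw [pow_two, h3]⟩)
  have hss : IsSemisimpleRing (A ⧸ Ring.jacobson A) := IsSemiprimaryRing.isSemisimpleRing
  rw [Ideal.jacobson_bot] at hJ
  have hlx : l x = 0 := by
    have := hl x
    rw [hxx] at this
    exact (smul_eq_zero.1 this.symm).resolve_right hx0
  have hrx : r x = 0 := by
    have := hr x
    rw [hxx] at this
    exact (smul_eq_zero.1 this.symm).resolve_right hx0
  let π := Ideal.Quotient.mk (Ring.jacobson A)
  have hπ : Function.Surjective π := Ideal.Quotient.mk_surjective
  let K : Ideal A := RingHom.ker l ⊓ RingHom.ker r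
  have hK : ∀ a, a ∈ K ↔ l a = 0 ∧ r a = 0 := fun a => Iff.rfl
  obtain ⟨e, he, hKe⟩ := IsSemisimpleRing.ideal_eq_span_idempotent (K.map π)
  have hmem : ∀ a, π a ∈ K.map π → a ∈ K := by
    intro a ha
    obtain ⟨b, hb, hab⟩ := (Ideal.mem_map_iff_of_surjective π hπ).1 ha
    have : a - b ∈ Ring.jacobson A := by
      rw [← Ideal.Quotient.mk_eq_mk_iff_sub_mem]; exact hab.symm
    obtain ⟨q, hq⟩ := (hJ _).1 this
    have : a = b + q • x := by rw [hq]; abel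
    rw [this]
    refine K.add_mem hb ((hK _).2 ?_)
    simp [hlx, hrx]
  obtain ⟨g0, rfl⟩ := hπ e
  have hg0K : g0 ∈ K := hmem _ (by rw [hKe]; exact Ideal.subset_span rfl)
  obtain ⟨hlg, hrg⟩ := (hK _).1 hg0K
  obtain ⟨q, hq⟩ : ∃ q : ℚ, q • x = g0 * g0 - g0 := by
    rw [← hJ, ← Ideal.Quotient.mk_eq_mk_iff_sub_mem]
    exact he
  have hgx : g0 * x = 0 := by simp [hl, hlg]
  have hxg : x * g0 = 0 := by simp [hr, hrg]
  have h3 : g0 * g0 * g0 = g0 * g0 := by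
    have := congrArg (· * g0) hq
    simp only [smul_mul_assoc, hxg, smul_zero, sub_mul] at this
    exact (sub_eq_zero.1 this.symm)
  obtain ⟨g, hg⟩ : ∃ g, g = g0 * g0 := ⟨_, rfl⟩
  have hgg : g * g = g := by rw [hg, ← mul_assoc, h3, h3]
  have hlg' : l g = 0 := by simp [hg, hlg]
  have hrg' : r g = 0 := by simp [hg, hrg]
  have hgx' : g * x = 0 := by simp [hl, hlg']
  have hxg' : x * g = 0 := by simp [hr, hrg']
  have hcent : ∀ a, g * a = a * g := by
    intro a
    have h1 : g * a - g * a * g = 0 := by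
      obtain ⟨q, hq⟩ := hsq (g * a - g * a * g) (by simp [hlg']) (by simp [hrg']) (by
        have : (g * a - g * a * g) * (g * a - g * a * g)
          = g * a * g * a - g * a * (g * g) * a - g * a * g * a * g + g * a * (g * g) * a * g := by
            noncomm_ring
        rw [this, hgg]; abel)
      have h4 : g * (g * a - g * a * g) = g * a - g * a * g := by
        have : g * (g * a - g * a * g) = (g * g) * a - (g * g) * a * g := by noncomm_ring
        rw [this, hgg]
      rw [← h4, ← hq, mul_smul_comm, hgx', smul_zero]
    have h2 : a * g - g * a * g = 0 := by
      obtain ⟨q, hq⟩ := hsq (a * g - g * a * g) (by simp [hlg']) (by simp [hrg']) (by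
        have : (a * g - g * a * g) * (a * g - g * a * g)
          = a * g * a * g - a * (g * g) * a * g - g * a * g * a * g + g * a * (g * g) * a * g := by
            noncomm_ring
        rw [this, hgg]; abel)
      have h4 : (a * g - g * a * g) * g = a * g - g * a * g := by
        have : (a * g - g * a * g) * g = a * (g * g) - g * a * (g * g) := by noncomm_ring
        rw [this, hgg]
      rw [← h4, ← hq, smul_mul_assoc, hxg', smul_zero]
    rw [sub_eq_zero.1 h1, sub_eq_zero.1 h2]
  refine ⟨g, hgg, hlg', hrg', hcent, ?_, ?_⟩
  · intro k h1 h2 h4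
    have : π k ∈ K.map π := Ideal.mem_map_of_mem _ ((hK k).2 ⟨h1, h2⟩)
    rw [hKe, Ideal.mem_span_singleton'] at this
    obtain ⟨b, hb⟩ := this
    obtain ⟨b, rfl⟩ := hπ b
    have hgg0 : π g = π g0 := by rw [hg, map_mul]; exact he
    rw [← hgg0, ← map_mul] at hb
    have hbk : k - b * g ∈ Ring.jacobson A := by
      rw [← Ideal.Quotient.mk_eq_mk_iff_sub_mem]; exact hb.symm
    obtain ⟨q, hq⟩ := (hJ _).1 hbk
    refine ⟨q, ?_⟩
    have h5 : g * (k - b * g) = 0 := by rw [← hq, mul_smul_comm, hgx', smul_zero]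
    have h6 : b * g = 0 := by
      rw [mul_sub, h4, zero_sub, neg_eq_zero, hcent, mul_assoc, hgg] at h5
      exact h5
    rw [hq, h6, sub_zero]
  · intro a ha
    obtain ⟨q, hq⟩ := hsq (g * a) (by simp [hlg']) (by simp [hrg']) ha
    have h4 : g * (g * a) = g * a := by rw [← mul_assoc, hgg]
    rw [← h4, ← hq, mul_smul_comm, hgx', smul_zero]

theorem split_case {A : Type u} [Ring A] [Algebra ℚ A] [FiniteDimensional ℚ A]
    (x : A) (hx0 : x ≠ 0)
    (l r : A →ₐ[ℚ] ℚ) (hl : ∀ a, a * x = l a • x) (hr : ∀ a, x * a = r a • x)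
    (hlx : l x = 0) (hrx : r x = 0)
    (hne : l ≠ r)
    (g : A) (hgg : g * g = g) (hlg : l g = 0) (hrg : r g = 0) (hcent : ∀ a, g * a = a * g)
    (hK : ∀ k, l k = 0 → r k = 0 → g * k = 0 → ∃ q : ℚ, q • x = k)
    (hred : ∀ a, g * a * (g * a) = 0 → g * a = 0) :
    ∃ (B : Type u) (_ : Ring B) (_ : Algebra ℚ B),
        FiniteDimensional ℚ B ∧ IsSemisimpleRing B ∧ IsReduced B ∧
        Nonempty (A ≃ₐ[ℚ] B × T2Q) := by
  have inj : ∀ p q : ℚ, p • x = q • x → p = q := fun p q h => smul_left_injective ℚ hx0 h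
  -- the idempotent e
  obtain ⟨e, hle, hre, hge⟩ : ∃ e, l e = 1 ∧ r e = 0 ∧ g * e = 0 := by
    obtain ⟨a, ha⟩ : ∃ a, l a ≠ r a := by
      by_contra h
      push Not at h
      exact hne (AlgHom.ext h)
    have ha' : l a - r a ≠ 0 := sub_ne_zero.2 ha
    refine ⟨(1 - g) * ((l a - r a)⁻¹ • (a - algebraMap ℚ A (r a))), ?_, ?_, ?_⟩
    · simp [hlg, ha']
    · simp [hrg]
    · rw [← mul_assoc, mul_sub, mul_one, hgg, sub_self, zero_mul]
  have heg : e * g = 0 := by rw [← hcent, hge]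
  have hex : e * x = x := by rw [hl, hle, one_smul]
  have hxe : x * e = 0 := by rw [hr, hre, zero_smul]
  have hgx : g * x = 0 := by rw [hl, hlg, zero_smul]
  have hee : e * e = e := by
    obtain ⟨q, hq⟩ := hK (e * e - e) (by simp [hle]) (by simp [hre])
      (by rw [mul_sub, ← mul_assoc, hge, zero_mul, sub_zero])
    have h1 : e * (e * e - e) = (e * e - e) * e := by noncomm_ring
    rw [← hq, mul_smul_comm, smul_mul_assoc, hex, hxe, smul_zero, hq] at h1
    exact sub_eq_zero.1 h1
  obtain ⟨f, hf⟩ : ∃ f, f = 1 - g - e := ⟨_, rfl⟩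
  have hsum : (1 : A) = g + e + f := by rw [hf]; abel
  have hlf : l f = 0 := by simp [hf, hlg, hle]
  have hrf : r f = 1 := by simp [hf, hrg, hre]
  have hgf : g * f = 0 := by rw [hf, mul_sub, mul_sub, mul_one, hgg, hge]; abel
  have hef : e * f = 0 := by rw [hf, mul_sub, mul_sub, mul_one, hee, heg]; abel
  have hfe : f * e = 0 := by rw [hf, sub_mul, sub_mul, one_mul, hee, hge]; abel
  have hxf : x * f = x := by rw [hr, hrf, one_smul]
  have hfx : f * x = 0 := by rw [hl, hlf, zero_smul]
  have hff : f * f = f := by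
    nth_rw 1 [hf]
    rw [sub_mul, sub_mul, one_mul, hgf, hef]; abel
  have heae : ∀ a, e * a * e = l a • e := by
    intro a
    obtain ⟨q, hq⟩ := hK (e * a * e - l a • e) (by simp [hle]) (by simp [hre])
      (by rw [mul_sub, mul_smul_comm, ← mul_assoc, ← mul_assoc, hge]; simp)
    have h1 : (e * a * e - l a • e) * e = e * a * e - l a • e := by
      rw [sub_mul, mul_assoc, hee, smul_mul_assoc, hee]
    rw [← hq, smul_mul_assoc, hxe, smul_zero, hq] at h1
    exact sub_eq_zero.1 h1.symm
  have hfaf : ∀ a, f * a * f = r a • f := by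
    intro a
    obtain ⟨q, hq⟩ := hK (f * a * f - r a • f) (by simp [hlf]) (by simp [hrf])
      (by rw [mul_sub, mul_smul_comm, ← mul_assoc, ← mul_assoc, hgf]; simp)
    have h1 : f * (f * a * f - r a • f) = f * a * f - r a • f := by
      rw [mul_sub, ← mul_assoc, ← mul_assoc, hff, mul_smul_comm, hff]
    rw [← hq, mul_smul_comm, hfx, smul_zero, hq] at h1
    exact sub_eq_zero.1 h1.symm
  have hmex : ∀ a, ∃ q : ℚ, q • x = e * a * f := fun a =>
    hK _ (by simp [hlf]) (by simp [hre]) (by rw [← mul_assoc, ← mul_assoc, hge]; simp)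
  choose m hm using hmex
  have hmmul : ∀ a b, m (a * b) = l a * m b + m a * r b := by
    intro a b
    apply inj
    rw [add_smul, mul_smul, hm, hm, mul_comm (m a), mul_smul, hm]
    have h1 : e * (a * b) * f = e * a * 1 * b * f := by noncomm_ring
    have h2 : e * a * (g + e + f) * b * f
        = e * (a * g) * b * f + e * a * e * (b * f) + e * a * (f * b * f) := by noncomm_ring
    have h3 : e * a * e * (b * f) = l a • (e * b * f) := by
      rw [heae, smul_mul_assoc, mul_assoc]
    have h4 : e * (a * g) * b * f = 0 := by
      rw [← hcent, ← mul_assoc, heg]; simp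
    rw [h1, hsum, h2, h4, h3, hfaf, mul_smul_comm, zero_add]
  let φ : A →ₐ[ℚ] Matrix (Fin 2) (Fin 2) ℚ :=
    { toFun := fun a => !![l a, m a; 0, r a]
      map_one' := by
        have : m 1 = 0 := inj _ _ (by rw [hm, mul_one, hef, zero_smul])
        rw [this, map_one, map_one, Matrix.one_fin_two]
      map_mul' := fun a b => by
        rw [Matrix.mul_fin_two, hmmul, map_mul, map_mul]; simp
      map_zero' := by
        have : m 0 = 0 := inj _ _ (by rw [hm]; simp)
        rw [this, map_zero, map_zero]
        ext i j; fin_cases i <;> fin_cases j <;> rfl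
      map_add' := fun a b => by
        have : m (a + b) = m a + m b := inj _ _ (by
          rw [add_smul, hm, hm, hm, mul_add, add_mul])
        rw [this, map_add, map_add]
        ext i j; fin_cases i <;> fin_cases j <;> simp
      commutes' := fun q => by
        have : m (algebraMap ℚ A q) = 0 := inj _ _ (by
          rw [hm, ← Algebra.commutes, mul_assoc, hef]; simp)
        rw [this, AlgHom.commutes, AlgHom.commutes]
        ext i j; fin_cases i <;> fin_cases j <;> simp [Matrix.algebraMap_matrix_apply] }
  have hφ : ∀ a, φ a = !![l a, m a; 0, r a] := fun a => rfl
  let ψ : A →ₐ[ℚ] T2Q := φ.codRestrict T2Q (fun a => by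
    change (φ a) 1 0 = 0
    rw [hφ]; rfl)
  let I : Ideal A :=
    { carrier := {a | g * a = 0}
      add_mem' := fun {a b} ha hb => by
        change g * (a + b) = 0
        rw [mul_add, show g * a = 0 from ha, show g * b = 0 from hb, add_zero]
      zero_mem' := mul_zero g
      smul_mem' := fun c a ha => by
        change g * (c * a) = 0
        rw [← mul_assoc, hcent, mul_assoc, show g * a = 0 from ha, mul_zero] }
  have hI : ∀ a, a ∈ I ↔ g * a = 0 := fun a => Iff.rfl
  have : I.IsTwoSided := ⟨fun {a} b ha => by
    rw [hI] at ha ⊢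
    rw [← mul_assoc, ha, zero_mul]⟩
  have hBred : IsReduced (A ⧸ I) := by
    rw [isReduced_iff_pow_one_lt 2 one_lt_two]
    intro b hb
    obtain ⟨a, rfl⟩ := Ideal.Quotient.mk_surjective b
    rw [pow_two, ← map_mul, Ideal.Quotient.eq_zero_iff_mem, hI] at hb
    rw [Ideal.Quotient.eq_zero_iff_mem, hI]
    apply hred
    rw [mul_assoc, ← mul_assoc a, ← hcent a, mul_assoc, hb, mul_zero]
  have hBfin : FiniteDimensional ℚ (A ⧸ I) := inferInstance
  refine ⟨A ⧸ I, inferInstance, inferInstance, hBfin, ?_, hBred, ⟨?_⟩⟩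
  · have : IsArtinianRing (A ⧸ I) := IsArtinianRing.of_finite ℚ _
    rw [IsArtinianRing.isSemisimpleRing_iff_jacobson, ← Ideal.jacobson_bot]
    obtain ⟨n, hn⟩ := IsArtinianRing.isNilpotent_jacobson_bot (R := A ⧸ I)
    rw [eq_bot_iff]
    intro y hy
    have h1 := Ideal.pow_mem_pow hy n
    rw [hn] at h1
    exact IsReduced.eq_zero y ⟨n, by simpa using h1⟩
  · refine AlgEquiv.ofBijective ((Ideal.Quotient.mkₐ ℚ I).prod ψ) ⟨?_, ?_⟩
    · rw [injective_iff_map_eq_zero]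
      intro a ha
      have h1 : Ideal.Quotient.mk I a = 0 := congrArg Prod.fst ha
      have h2 : φ a = 0 := congrArg Subtype.val (congrArg Prod.snd ha)
      rw [Ideal.Quotient.eq_zero_iff_mem, hI] at h1
      rw [hφ] at h2
      have hla : l a = 0 := congrFun (congrFun h2 0) 0
      have hma : m a = 0 := congrFun (congrFun h2 0) 1
      have hra : r a = 0 := congrFun (congrFun h2 1) 1
      obtain ⟨q, hq⟩ := hK a hla hra h1
      have h3 := hm a
      rw [hma, zero_smul, ← hq, mul_smul_comm, smul_mul_assoc, hex, hxf, hq] at h3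
      exact h3.symm
    · rintro ⟨b, M, hM⟩
      obtain ⟨b, rfl⟩ := Ideal.Quotient.mk_surjective b
      have hM' : M 1 0 = 0 := hM
      refine ⟨g * b + M 0 0 • e + M 0 1 • x + M 1 1 • f, Prod.ext ?_ (Subtype.ext ?_)⟩
      · change Ideal.Quotient.mk I _ = Ideal.Quotient.mk I b
        rw [Ideal.Quotient.mk_eq_mk_iff_sub_mem, hI]
        simp only [mul_sub, mul_add, mul_smul_comm, hge, hgx, hgf, ← mul_assoc, hgg]
        simp
      · change φ _ = M
        rw [hφ]
        have h1 : m (g * b + M 0 0 • e + M 0 1 • x + M 1 1 • f) = M 0 1 := by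
          apply inj
          rw [hm]
          simp only [mul_add, add_mul, mul_smul_comm, smul_mul_assoc, hex, hxf, hee, hef,
            ← mul_assoc, heg]
          simp
        rw [h1]
        ext i j; fin_cases i <;> fin_cases j <;> simp [hM', hlg, hrg, hle, hre, hlx, hrx, hlf, hrf]

theorem radical_central_or_summand_T2Q
    (A : Type u) [Ring A] [Algebra ℚ A] [FiniteDimensional ℚ A]
    (hA : HasHyperbolicProperty A)
    (hJ : (⊥ : Ideal A).jacobson ≠ ⊥) :
    (((⊥ : Ideal A).jacobson : Set A) ⊆ Set.center A) ∨
      ∃ (B : Type u) (_ : Ring B) (_ : Algebra ℚ B),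
        FiniteDimensional ℚ B ∧ IsSemisimpleRing B ∧ IsReduced B ∧
        Nonempty (A ≃ₐ[ℚ] B × T2Q) := by
  obtain ⟨x, hx0, hxx, hgen⟩ := exists_radical_gen hA hJ
  have hxJ : x ∈ (⊥ : Ideal A).jacobson := (hgen x).2 ⟨1, one_smul _ _⟩
  obtain ⟨l, hl⟩ := exists_char x hx0 (fun a => (hgen _).1 (Ideal.mul_mem_left _ a hxJ))
  obtain ⟨r, hr⟩ := exists_char' x hx0 (fun a => (hgen _).1 (Ideal.mul_mem_right a _ hxJ))
  by_cases hne : l = r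
  · left
    intro a ha
    obtain ⟨q, rfl⟩ := (hgen a).1 ha
    rw [Semigroup.mem_center_iff]
    intro b
    rw [mul_smul_comm, smul_mul_assoc, hl, hr, hne]
  · right
    obtain ⟨g, h1, h2, h3, h4, h5, h6⟩ := exists_g hA x hx0 hxx hgen l r hl hr
    have hlx : l x = 0 := by
      have := hl x
      rw [hxx] at this
      exact (smul_eq_zero.1 this.symm).resolve_right hx0
    have hrx : r x = 0 := by
      have := hr x
      rw [hxx] at this
      exact (smul_eq_zero.1 this.symm).resolve_right hx0
    exact split_case x hx0 l r hl hr hlx hrx hne g h1 h2 h3 h4 h5 h6
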